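/- Let SN ≥ 2, ON ≥ 1, fit : Fin SN → ℝ non-constant, fit_res(j) = (fit(j) − min_k fit(k)) / (max_k fit(k) − min_k fit(k)), S = Σ_k fit_res(k), and N_j = ⌊ON · fit_res(j) / S⌋. Let j* be an index attaining the maximum of fit, and assign to j* the extra bees ON − Σ_j N_j in addition to N_{j*}. Then the total number of onlookers received by j*, namely N_{j*} + (ON − Σ_j N_j), is at least 1; that is, at least one onlooker is always sent to a best food source. -/

import Mathlib

/-- **At least one onlooker is always sent to a best food source (AsBeC).**
With `N j = ⌊ON · fit_res j / S⌋` and the leftover `ON − Σ_j N j` onlookers assigned to a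
maximizer `j*` of `fit`, the total number of onlookers received by `j*` is at least `1`. -/
theorem strictly_biased_assignment_best
    (SN ON : ℕ) (hSN : 2 ≤ SN) (hON : 1 ≤ ON) (fit : Fin SN → ℝ)
    (hne : (Finset.univ : Finset (Fin SN)).Nonempty)
    (hnc : Finset.univ.inf' hne fit < Finset.univ.sup' hne fit)
    (fit_res : Fin SN → ℝ)
    (hdef : ∀ j, fit_res j =
      (fit j - Finset.univ.inf' hne fit) /
        (Finset.univ.sup' hne fit - Finset.univ.inf' hne fit))
    (S : ℝ) (hS : S = ∑ k, fit_res k)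
    (N : Fin SN → ℤ) (hN : ∀ j, N j = ⌊(ON : ℝ) * fit_res j / S⌋)
    (jstar : Fin SN) (hjstar : fit jstar = Finset.univ.sup' hne fit) :
    1 ≤ N jstar + ((ON : ℤ) - ∑ j, N j) := by
  have hd : 0 < Finset.univ.sup' hne fit - Finset.univ.inf' hne fit := sub_pos.mpr hnc
  have hr : ∀ j, 0 ≤ fit_res j := fun j => by
    rw [hdef]
    exact div_nonneg (sub_nonneg.mpr (Finset.inf'_le fit (Finset.mem_univ j))) hd.le
  have h1 : fit_res jstar = 1 := by
    rw [hdef, hjstar]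
    exact div_self hd.ne'
  have hSpos : 0 < S := by
    have h := Finset.single_le_sum (f := fit_res) (fun j _ => hr j) (Finset.mem_univ jstar)
    rw [← hS] at h
    linarith
  have hg := Finset.single_le_sum (f := fun j => (ON : ℝ) * fit_res j / S - (N j : ℝ))
    (fun j _ => by
      have h := Int.floor_le ((ON : ℝ) * fit_res j / S)
      rw [← hN] at h
      exact sub_nonneg.mpr h) (Finset.mem_univ jstar)
  have hsum : ∑ j, (ON : ℝ) * fit_res j / S = ON := by
    rw [← Finset.sum_div, ← Finset.mul_sum, ← hS]
    exact mul_div_cancel_right₀ _ hSpos.ne'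
  rw [Finset.sum_sub_distrib, hsum, h1] at hg
  have hpos : 0 < (ON : ℝ) * 1 / S := by
    have : (0 : ℝ) < ON := by exact_mod_cast hON
    positivity
  have hfin : (0 : ℝ) < ((N jstar + ((ON : ℤ) - ∑ j, N j) : ℤ) : ℝ) := by
    push_cast
    linarith
  have : 0 < N jstar + ((ON : ℤ) - ∑ j, N j) := by exact_mod_cast hfin
  omega
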